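/- If a finite connected graph G has a unique perfect matching M, then G has a bridge (a cut edge) that belongs to M. -/

import Mathlib

namespace SimpleGraph

universe u

variable {V : Type u} {W : Type*}

/-- `G.IsMatchable S` says that some map pairs up the vertices of `S` along edges of `G`. -/
def IsMatchable (G : SimpleGraph V) (S : Set V) : Prop :=
  ∃ h : V → V, ∀ x ∈ S, h x ∈ S ∧ G.Adj x (h x) ∧ h (h x) = x

/-- `m` sends every vertex to its partner in a perfect matching of `G`. -/
def IsPartnerMap (G : SimpleGraph V) (m : V → V) : Prop :=
  ∀ x, G.Adj x (m x) ∧ m (m x) = x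

lemma IsMatchable.union {G : SimpleGraph V} {S T : Set V} (hS : G.IsMatchable S)
    (hT : G.IsMatchable T) (hd : Disjoint S T) : G.IsMatchable (S ∪ T) := by
  classical
  obtain ⟨f, hf⟩ := hS
  obtain ⟨g, hg⟩ := hT
  rw [Set.disjoint_left] at hd
  refine ⟨fun x => if x ∈ S then f x else g x, fun x hx => ?_⟩
  simp only [Set.mem_union] at hx ⊢
  grind

lemma IsMatchable.pair {G : SimpleGraph V} {x y : V} (h : G.Adj x y) :
    G.IsMatchable {x, y} := by
  classical
  refine ⟨fun z => if z = x then y else x, fun z hz => ?_⟩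
  have := h.ne
  have := h.symm
  simp only [Set.mem_insert_iff, Set.mem_singleton_iff] at hz ⊢
  grind

lemma IsMatchable.image_Ico {G : SimpleGraph V} {c : ℕ → V} {K : ℕ}
    (hinj : Set.InjOn c (Set.Iio K)) (hadj : ∀ i, i + 1 < K → G.Adj (c i) (c (i + 1)))
    (a l : ℕ) (hl : a + 2 * l ≤ K) : G.IsMatchable (c '' Set.Ico a (a + 2 * l)) := by
  induction l with
  | zero => exact ⟨id, by simp⟩
  | succ l ih =>
    have h1 := (ih (by omega)).union (IsMatchable.pair (hadj (a + 2 * l) (by omega))) (by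
      rw [Set.disjoint_left]
      rintro _ ⟨i, hi, rfl⟩ hx
      simp only [Set.mem_Ico] at hi
      rcases hx with hx | hx
      · have := hinj (Set.mem_Iio.2 (by omega)) (Set.mem_Iio.2 (by omega)) hx
        omega
      · have := hinj (Set.mem_Iio.2 (by omega)) (Set.mem_Iio.2 (by omega)) hx
        omega)
    convert h1 using 1
    rw [← Set.image_pair, ← Set.image_union]
    congr 1
    ext i
    simp only [Set.mem_Ico, Set.mem_union, Set.mem_insert_iff, Set.mem_singleton_iff]
    omega

/-- An edge whose complement is matchable belongs to the unique perfect matching. -/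
lemma IsPartnerMap.eq_of_isMatchable_compl {G : SimpleGraph V} {m : V → V}
    (huniq : ∀ f, G.IsPartnerMap f → f = m) {x y : V} (hxy : G.Adj x y)
    (h : G.IsMatchable ({x, y}ᶜ : Set V)) : m x = y := by
  classical
  obtain ⟨f, hf⟩ := h
  have hne := hxy.ne
  have hyx := hxy.symm
  have := huniq (fun z => if z = x then y else if z = y then x else f z) (fun z => by
    have := hf z
    simp only [Set.mem_compl_iff, Set.mem_insert_iff, Set.mem_singleton_iff] at this
    grind)
  rw [← this]
  simp

/-- Reachability is preserved by maps that send every edge to an edge or to a single vertex. -/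
lemma Reachable.map_of_eq_or_adj {H : SimpleGraph V} {H' : SimpleGraph W} {φ : V → W}
    (hφ : ∀ x y, H.Adj x y → φ x = φ y ∨ H'.Adj (φ x) (φ y)) {x y : V}
    (h : H.Reachable x y) : H'.Reachable (φ x) (φ y) := by
  obtain ⟨p⟩ := h
  induction p with
  | nil => rfl
  | cons hadj _ ih =>
    rcases hφ _ _ hadj with h | h
    · rwa [h]
    · exact h.reachable.trans ih

/-- A graph with a unique perfect matching and no vertex of degree one has a nontrivial
factor-critical set `B` which is left by the matching only from its vertex `r`. -/
lemma IsPartnerMap.exists_blossom [Finite V] [Nonempty V] {G : SimpleGraph V} {m : V → V}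
    (hm : G.IsPartnerMap m) (huniq : ∀ f, G.IsPartnerMap f → f = m)
    (hn : ∀ v, ∃ w, G.Adj v w ∧ w ≠ m v) :
    ∃ (B : Set V) (r : V), r ∈ B ∧ m r ∉ B ∧ (∃ s ∈ B, s ≠ r) ∧
      (∀ x ∈ B, x ≠ r → m x ∈ B ∧ m x ≠ r) ∧ ∀ b ∈ B, G.IsMatchable (B \ {b}) := by
  classical
  choose n hnadj hnm using hn
  let c : ℕ → V := fun i => Nat.rec (motive := fun _ => V) (Classical.arbitrary V)
    (fun i v => if Even i then m v else n v) i
  have hceven : ∀ i, Even i → c (i + 1) = m (c i) := fun i hi => if_pos hi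
  have hcodd : ∀ i, ¬ Even i → c (i + 1) = n (c i) := fun i hi => if_neg hi
  clear_value c
  have hcm : ∀ i, ¬ Even i → m (c i) = c (i - 1) := by
    intro i hi
    obtain ⟨j, rfl⟩ : ∃ j, i = j + 1 := ⟨i - 1, by grind⟩
    rw [hceven j (by grind), (hm _).2, Nat.add_sub_cancel]
  have hadj : ∀ i, G.Adj (c i) (c (i + 1)) := by
    intro i
    by_cases hi : Even i
    · rw [hceven i hi]; exact (hm _).1
    · rw [hcodd i hi]; exact hnadj _
  have hex : ∃ K, ∃ t < K, c t = c K := by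
    obtain ⟨i, j, hij, h⟩ := Finite.exists_ne_map_eq_of_infinite c
    rcases lt_or_gt_of_ne hij with h' | h'
    · exact ⟨j, i, h', h⟩
    · exact ⟨i, j, h', h.symm⟩
  obtain ⟨K, ⟨t, htK, htc⟩, hmin⟩ :
      ∃ K, (∃ t < K, c t = c K) ∧ ∀ L < K, ¬ ∃ t < L, c t = c L :=
    ⟨_, Nat.find_spec hex, fun _ => Nat.find_min hex⟩
  have hinj : Set.InjOn c (Set.Iio K) := by
    intro i hi j hj h
    rcases lt_trichotomy i j with h' | h' | h'
    · exact (hmin j hj ⟨i, h', h⟩).elim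
    · exact h'
    · exact (hmin i hi ⟨j, h', h.symm⟩).elim
  have hcinj : ∀ i j, i < K → j < K → c i = c j → i = j := fun i j hi hj h => hinj hi hj h
  have hKeven : Even K := by
    by_contra hK
    have h1 := hcm K hK
    rw [← htc] at h1
    by_cases ht : Even t
    · rw [← hceven t ht] at h1
      by_cases h2 : t + 1 = K
      · exact (hadj t).ne (by rw [h2, htc])
      · have := hcinj _ _ (by omega) (by omega) h1
        grind
    · rw [hcm t ht] at h1
      have := hcinj _ _ (by omega) (by omega) h1
      grind
  have hlast : n (c (K - 1)) = c t := by
    rw [← hcodd _ (by grind), htc]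
    congr 1
    omega
  have hmem : ∀ a, a ≤ K → ∀ i, i < K → (c i ∈ c '' Set.Ico a K ↔ a ≤ i) := by
    intro a ha i hi
    constructor
    · rintro ⟨j, hj, h⟩
      have := hcinj _ _ hj.2 hi h
      exact this ▸ hj.1
    · exact fun h => ⟨i, ⟨h, hi⟩, rfl⟩
  have hclosed : ∀ a, Even a → ∀ x ∈ c '' Set.Ico a K, m x ∈ c '' Set.Ico a K := by
    rintro a ha _ ⟨i, hi, rfl⟩
    simp only [Set.mem_Ico] at hi
    by_cases he : Even i
    · rw [← hceven i he]
      exact ⟨i + 1, ⟨by omega, by grind⟩, rfl⟩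
    · rw [hcm i he]
      exact ⟨i - 1, ⟨by grind, by omega⟩, rfl⟩
  have hdisj : ∀ I J : Set ℕ, (∀ j, (j ∈ I → j < K) ∧ (j ∈ J → j < K) ∧ ¬ (j ∈ I ∧ j ∈ J)) →
      Disjoint (c '' I) (c '' J) := by
    intro I J h
    rw [Set.disjoint_left]
    rintro _ ⟨i, hi, rfl⟩ ⟨j, hj, hji⟩
    obtain rfl := hcinj _ _ ((h j).2.1 hj) ((h i).1 hi) hji
    exact (h j).2.2 ⟨hi, hj⟩
  have hseg := IsMatchable.image_Ico hinj (fun i _ => hadj i)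
  have ht : ¬ Even t := by
    intro ht
    refine hnm (c (K - 1)) ?_
    rw [hlast]
    symm
    apply IsPartnerMap.eq_of_isMatchable_compl huniq
    · rw [← hlast]; exact hnadj _
    obtain ⟨l, hl⟩ : ∃ l, K = t + 2 * l + 2 := by
      obtain ⟨a, rfl⟩ := hKeven
      obtain ⟨b, rfl⟩ := ht
      exact ⟨a - b - 1, by omega⟩
    have hout : G.IsMatchable (c '' Set.Ico t K)ᶜ := by
      refine ⟨m, fun x hx => ⟨fun h => hx ?_, hm x⟩⟩
      rw [← (hm x).2]
      exact hclosed t ht _ h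
    convert (hseg (t + 1) l (by omega)).union hout ?_ using 1
    · ext x
      by_cases hx : x ∈ c '' Set.Ico t K
      · simp only [Set.mem_compl_iff, Set.mem_insert_iff, Set.mem_singleton_iff,
          Set.mem_union, hx, not_true_eq_false, or_false]
        obtain ⟨i, hi, rfl⟩ := hx
        simp only [Set.mem_Ico] at hi
        constructor
        · intro h
          have h1 : i ≠ K - 1 := fun e => h (Or.inl (by rw [e]))
          have h2 : i ≠ t := fun e => h (Or.inr (by rw [e]))
          exact ⟨i, ⟨by omega, by omega⟩, rfl⟩
        · rintro ⟨j, hj, hji⟩ h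
          simp only [Set.mem_Ico] at hj
          have hij := hcinj _ _ (by omega) (by omega) hji
          rcases h with h | h
          · have := hcinj _ _ (by omega) (by omega) h
            omega
          · have := hcinj _ _ (by omega) (by omega) h
            omega
      · have h1 : x ∈ (({c (K - 1), c t} : Set V))ᶜ := by
          rintro (rfl | rfl)
          · exact hx ⟨_, ⟨by omega, by omega⟩, rfl⟩
          · exact hx ⟨_, ⟨by omega, by omega⟩, rfl⟩
        exact iff_of_true h1 (Or.inr hx)
    · refine Set.disjoint_compl_right_iff_subset.2 (Set.image_mono fun i hi => ?_)
      simp only [Set.mem_Ico] at hi ⊢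
      omega
  have htK' : t + 1 ≠ K := by
    intro h
    have := (hnadj (c (K - 1))).ne
    rw [hlast] at this
    exact this (by rw [← h]; rfl)
  refine ⟨c '' Set.Ico t K, c t, ⟨t, ⟨le_rfl, htK⟩, rfl⟩, ?_, ?_, ?_, ?_⟩
  · rw [hcm t ht, hmem t htK.le _ (by omega)]
    grind
  · refine ⟨c (t + 1), ⟨t + 1, ⟨by omega, by omega⟩, rfl⟩, (hadj t).ne'⟩
  · rintro _ ⟨i, hi, rfl⟩ hne
    simp only [Set.mem_Ico] at hi
    have hit : i ≠ t := fun e => hne (by rw [e])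
    obtain ⟨j, hj, hji⟩ := hclosed (t + 1) (by grind) (c i) ⟨i, ⟨by omega, hi.2⟩, rfl⟩
    simp only [Set.mem_Ico] at hj
    rw [← hji]
    refine ⟨⟨j, ⟨by omega, hj.2⟩, rfl⟩, fun h => ?_⟩
    have := hcinj _ _ hj.2 htK h
    omega
  · rintro _ ⟨i, hi, rfl⟩
    simp only [Set.mem_Ico] at hi
    have hdiff : c '' Set.Ico t K \ {c i} = c '' (Set.Ico t K \ {i}) := by
      rw [← Set.image_singleton, Set.InjOn.image_sdiff_subset (hinj.mono fun j hj => hj.2)]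
      simpa using hi
    rw [hdiff]
    by_cases he : Even i
    · obtain ⟨k, hk⟩ := hKeven
      obtain ⟨l, hl⟩ := he
      obtain ⟨s, hs⟩ := Nat.not_even_iff_odd.1 ht
      have hpair : G.IsMatchable (c '' {K - 1, t}) := by
        rw [Set.image_pair]
        exact IsMatchable.pair (hlast ▸ hnadj _)
      have h1 := hseg (t + 1) (l - s - 1) (by omega)
      have h2 := hseg (i + 1) (k - l - 1) (by omega)
      have h3 := (h1.union h2 (hdisj _ _ (by simp only [Set.mem_Ico]; omega))).union hpair (by
        rw [← Set.image_union]
        apply hdisj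
        intro j
        simp only [Set.mem_Ico, Set.mem_union, Set.mem_insert_iff, Set.mem_singleton_iff]
        omega)
      rw [← Set.image_union, ← Set.image_union] at h3
      convert h3 using 2
      ext j
      simp only [Set.mem_Ico, Set.mem_union, Set.mem_insert_iff, Set.mem_singleton_iff,
        Set.mem_sdiff]
      omega
    · obtain ⟨k, hk⟩ := hKeven
      obtain ⟨l, hl⟩ := Nat.not_even_iff_odd.1 he
      obtain ⟨s, hs⟩ := Nat.not_even_iff_odd.1 ht
      have h1 := hseg t (l - s) (by omega)
      have h2 := hseg (i + 1) (k - l - 1) (by omega)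
      have h3 := h1.union h2 (hdisj _ _ (by simp only [Set.mem_Ico]; omega))
      rw [← Set.image_union] at h3
      convert h3 using 2
      ext j
      simp only [Set.mem_Ico, Set.mem_union, Set.mem_singleton_iff, Set.mem_sdiff]
      omega

/-- Some edge of a unique perfect matching of a finite connected graph is a bridge. The proof
contracts a factor-critical set to a vertex and applies induction to the contracted graph. -/
theorem IsPartnerMap.exists_isBridge {V : Type u} [Finite V] {G : SimpleGraph V} {m : V → V}
    (hconn : G.Connected) (hm : G.IsPartnerMap m) (huniq : ∀ f, G.IsPartnerMap f → f = m) :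
    ∃ v, G.IsBridge s(v, m v) := by
  classical
  induction hcard : Nat.card V using Nat.strong_induction_on generalizing V with
  | _ N ih =>
  subst hcard
  have := hconn.nonempty
  by_cases hn : ∀ v, ∃ w, G.Adj v w ∧ w ≠ m v
  · obtain ⟨B, r, hrB, hmr, ⟨s, hsB, hsr⟩, hB, hcrit⟩ := hm.exists_blossom huniq hn
    let W := {x : V // x ∈ B → x = r}
    let φ : V → W := fun x => if h : x ∈ B then ⟨r, fun _ => rfl⟩ else ⟨x, fun h' => (h h').elim⟩
    have hφB : ∀ x ∈ B, (φ x).1 = r := fun x hx => by simp [φ, hx]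
    have hφn : ∀ x, x ∉ B → (φ x).1 = x := fun x hx => by simp [φ, hx]
    have hφW : ∀ w : W, φ w.1 = w := by
      intro w
      apply Subtype.ext
      by_cases h : w.1 ∈ B
      · rw [hφB _ h, w.2 h]
      · exact hφn _ h
    let H : SimpleGraph W :=
      { Adj := fun w w' => w ≠ w' ∧ ∃ x y, G.Adj x y ∧ φ x = w ∧ φ y = w'
        symm := ⟨fun w w' ⟨h, x, y, hxy, hx, hy⟩ => ⟨h.symm, y, x, hxy.symm, hy, hx⟩⟩
        loopless := ⟨fun w h => h.1 rfl⟩ }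
    have hmW : ∀ w : W, m w.1 ∈ B → m w.1 = r := by
      intro w hw
      by_contra hne
      have h1 := hB _ hw hne
      rw [(hm _).2] at h1
      exact h1.2 (w.2 h1.1)
    let m' : W → W := fun w => ⟨m w.1, hmW w⟩
    have hHG : ∀ w w' : W, H.Adj w w' → w.1 ∉ B → w'.1 ∉ B → G.Adj w.1 w'.1 := by
      rintro w w' ⟨_, x, y, hxy, rfl, rfl⟩ hx hy
      have hx' : x ∉ B := fun h => hx (by rw [hφB x h]; exact hrB)
      have hy' : y ∉ B := fun h => hy (by rw [hφB y h]; exact hrB)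
      rwa [hφn x hx', hφn y hy']
    have hm' : H.IsPartnerMap m' := by
      intro w
      refine ⟨⟨fun h => (hm w.1).1.ne (congrArg Subtype.val h), w.1, m w.1, (hm _).1, hφW w,
        hφW (m' w)⟩, Subtype.ext (hm w.1).2⟩
    let r' : W := ⟨r, fun _ => rfl⟩
    have hlift : ∀ g, H.IsPartnerMap g → ∀ b ∈ B, G.Adj b (g r').1 → b = r ∧ g = m' := by
      intro g hg b hb hby
      obtain ⟨h, hh⟩ := hcrit b hb
      have hyr : g r' ≠ r' := (hg r').1.ne'
      have hyB : (g r').1 ∉ B := fun e => hyr (Subtype.ext ((g r').2 e))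
      have hN := huniq (fun x => if x = b then (g r').1 else if x = (g r').1 then b else
        if x ∈ B then h x else (g (φ x)).1) (fun x => by
          by_cases hxb : x = b
          · subst hxb
            have : (g r').1 ≠ x := hby.ne'
            simp [this, hby]
          by_cases hxy : x = (g r').1
          · subst hxy
            simp [hxb, hby.symm]
          by_cases hxB : x ∈ B
          · have := hh x ⟨hxB, hxb⟩
            have h1 : h x ≠ b := this.1.2
            have h2 : h x ≠ (g r').1 := fun e => hyB (e ▸ this.1.1)
            simp only [hxb, hxy, hxB, h1, h2, this.1.1, if_true, if_false]
            exact this.2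
          · have hxr : φ x ≠ r' := fun e => hxB (by rw [← hφn x hxB, e]; exact hrB)
            have hxg : g (φ x) ≠ r' := fun e => hxy (by
              rw [← e, (hg _).2, hφn x hxB])
            have h1 : (g (φ x)).1 ∉ B := fun e => hxg (Subtype.ext ((g (φ x)).2 e))
            have h2 : (g (φ x)).1 ≠ b := fun e => h1 (by rw [e]; exact hb)
            have h3 : (g (φ x)).1 ≠ (g r').1 := fun e => hxr (by
              rw [← (hg (φ x)).2, Subtype.ext e, (hg _).2])
            simp only [hxb, hxy, hxB, h1, h2, h3, if_false]
            refine ⟨?_, ?_⟩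
            · have := hHG _ _ (hg (φ x)).1 (by rwa [hφn x hxB]) h1
              rwa [hφn x hxB] at this
            · rw [hφW, (hg _).2, hφn x hxB])
      have hmb : m b = (g r').1 := by rw [← hN]; simp
      have hbr : b = r := by
        by_contra hne
        exact hyB (hmb ▸ (hB b hb hne).1)
      refine ⟨hbr, funext fun w => Subtype.ext ?_⟩
      change (g w).1 = m w.1
      subst hbr
      by_cases hw : w = r'
      · rw [hw]; exact hmb.symm
      have hwB : w.1 ∉ B := fun e => hw (Subtype.ext (w.2 e))
      by_cases hwy : w = g r'
      · rw [hwy, (hg _).2, ← hmb, (hm _).2]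
      · rw [← hN]
        have h1 : w.1 ≠ b := fun e => hwB (by rw [e]; exact hb)
        have h2 : w.1 ≠ (g r').1 := fun e => hwy (Subtype.ext e)
        simp only [h1, h2, hwB, if_false, hφW]
    have huniq' : ∀ g, H.IsPartnerMap g → g = m' := by
      intro g hg
      obtain ⟨hne, x, y, hxy, hx, hy⟩ := (hg r').1
      have hyB : y ∉ B := fun e => hne (by rw [← hy]; exact Subtype.ext (hφB y e).symm)
      have hxB : x ∈ B := by
        by_contra e
        have := hφn x e
        rw [hx] at this
        exact e (this ▸ hrB)
      refine (hlift g hg x hxB ?_).2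
      rwa [← hy, hφn y hyB]
    have hpar : ∀ b ∈ B, G.Adj b (m r) → b = r := fun b hb h => (hlift m' hm' b hb h).1
    have hφadj : ∀ x y, G.Adj x y → φ x = φ y ∨ H.Adj (φ x) (φ y) := by
      intro x y hxy
      by_cases h : φ x = φ y
      · exact Or.inl h
      · exact Or.inr ⟨h, x, y, hxy, rfl, rfl⟩
    have hHconn : H.Connected := by
      have : Nonempty W := ⟨r'⟩
      refine ⟨fun w w' => ?_⟩
      rw [← hφW w, ← hφW w']
      exact Reachable.map_of_eq_or_adj hφadj (hconn.preconnected _ _)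
    have hlt : Nat.card W < Nat.card V :=
      Finite.card_subtype_lt (x := s) (fun h => hsr (h hsB))
    obtain ⟨w, hw⟩ := ih _ hlt hHconn hm' huniq' rfl
    refine ⟨w.1, ?_⟩
    -- an edge of `G` over the matching edge at `w` is that matching edge
    have hover : ∀ (w : W) x y, G.Adj x y → φ x = w → φ y = m' w → x = w.1 ∧ y = m w.1 := by
      intro w x y hxy hx hy
      have hx1 : (φ x).1 = w.1 := congrArg Subtype.val hx
      have hy1 : (φ y).1 = m w.1 := congrArg Subtype.val hy
      by_cases hxB : x ∈ B
      · rw [hφB x hxB] at hx1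
        rw [← hx1] at hy1 ⊢
        have hyB : y ∉ B := fun e => hmr (by rw [← hy1, hφB y e]; exact hrB)
        rw [hφn y hyB] at hy1
        exact ⟨hpar x hxB (hy1 ▸ hxy), hy1⟩
      · rw [hφn x hxB] at hx1
        refine ⟨hx1, ?_⟩
        by_cases hyB : y ∈ B
        · rw [hφB y hyB] at hy1
          have hmrw : m r = w.1 := (congrArg m hy1).trans (hm _).2
          rw [← hy1]
          exact hpar y hyB (by rw [hmrw, ← hx1]; exact hxy.symm)
        · rwa [hφn y hyB] at hy1
    rw [isBridge_iff] at hw ⊢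
    intro hreach
    apply hw
    have := Reachable.map_of_eq_or_adj (φ := φ) (H' := H.deleteEdges {s(w, m' w)}) ?_ hreach
    · rwa [hφW, show m w.1 = (m' w).1 from rfl, hφW] at this
    intro x y hxy
    rw [deleteEdges_adj, Set.mem_singleton_iff] at hxy
    refine (hφadj x y hxy.1).imp id fun h => deleteEdges_adj.2 ⟨h, fun he => hxy.2 ?_⟩
    rcases Sym2.eq_iff.1 he with ⟨hx, hy⟩ | ⟨hx, hy⟩
    · obtain ⟨rfl, rfl⟩ := hover w x y hxy.1 hx hy
      rfl
    · obtain ⟨rfl, rfl⟩ := hover w y x hxy.1.symm hy hx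
      exact Sym2.eq_swap
  · push Not at hn
    obtain ⟨v, hv⟩ := hn
    refine ⟨v, ?_⟩
    rw [isBridge_iff]
    intro hreach
    obtain ⟨w, hw⟩ := hreach.nonempty_neighborSet_left (hm v).1.ne
    rw [mem_neighborSet, deleteEdges_adj, hv w hw.1] at hw
    exact hw.2 rfl

end SimpleGraph

/-- Kotzig: a finite connected graph with a unique perfect matching has a bridge
belonging to that matching. -/
theorem kotzig_unique_pm_bridge {V : Type*} [Fintype V] (G : SimpleGraph V)
    (hconn : G.Connected) (M : G.Subgraph) (hM : M.IsPerfectMatching)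
    (huniq : ∀ M' : G.Subgraph, M'.IsPerfectMatching → M' = M) :
    ∃ e ∈ M.edgeSet, G.IsBridge e := by
  have hM' := SimpleGraph.Subgraph.isPerfectMatching_iff.1 hM
  choose m hm hmu using hM'
  obtain ⟨v, hv⟩ := SimpleGraph.IsPartnerMap.exists_isBridge (m := m) hconn
    (fun x => ⟨(hm x).adj_sub, (hmu (m x) x (hm x).symm).symm⟩) (fun f hf => by
      let M' : G.Subgraph :=
        { verts := Set.univ
          Adj := fun x y => f x = y
          adj_sub := fun {x y} h => h ▸ (hf x).1
          edge_vert := fun _ => Set.mem_univ _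
          symm := ⟨fun x y h => h ▸ (hf x).2⟩ }
      have h := huniq M' (SimpleGraph.Subgraph.isPerfectMatching_iff.2
        fun x => ⟨f x, rfl, fun y hy => Eq.symm hy⟩)
      funext x
      refine hmu x (f x) ?_
      rw [← h])
  exact ⟨_, hm v, hv⟩
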